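/- Suppose that for each u coprime to n·c there is a family of diagonal matrices Z_u(k/c), indexed by integers k coprime to c and depending only on k modulo c, each of multiplicative order dividing c, such that σ_u(Λ(k/c)) = Λ(uk/c)·G_u·Z_u(x/c) = Z_u(k/c)·G_u^{−1}·Λ(ûk/c), where x is an inverse of k modulo c and û an inverse of u modulo c, and such that Z_u((k'·k)/c) = Z_u(k/c)^{k'} for every k' coprime to c. Then for all l, m coprime to n·c and all k coprime to c: G_l^{−1}·Z_m(l̂k/c)·G_l = Z_{lm}(k/c)·Z_l(k/c)^{−m}, where l̂ is an inverse of l modulo c. -/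

import Mathlib

open Matrix Complex

abbrev SL2Z := Matrix.SpecialLinearGroup (Fin 2) ℤ

def sM : SL2Z := ⟨!![0, -1; 1, 0], by norm_num [Matrix.det_fin_two_of]⟩
def tM : SL2Z := ⟨!![1, 1; 0, 1], by norm_num [Matrix.det_fin_two_of]⟩

theorem exists_ringHom_extending {R L M : Type*} [CommRing R] [Field L] [Field M]
    [IsAlgClosed M] [Algebra R L] [Algebra.IsAlgebraic R L] [FaithfulSMul R L]
    (f : R →+* M) (hf : Function.Injective f) :
    ∃ σ : L →+* M, ∀ r, σ (algebraMap R L r) = f r := by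
  let := f.toAlgebra
  have : IsDomain R := (FaithfulSMul.algebraMap_injective R L).isDomain (algebraMap R L)
  have : FaithfulSMul R M := (faithfulSMul_iff_algebraMap_injective R M).2 hf
  exact ⟨(IsAlgClosed.lift : L →ₐ[R] M).toRingHom, fun r => AlgHom.commutes _ r⟩

theorem RingEquiv.exists_ringHom_extending {K L : Type*} [Field K] [Field L] [IsAlgClosed L]
    (i : K →+* L) (τ : K ≃+* K) : ∃ σ : L →+* L, ∀ x, σ (i x) = i (τ x) := by
  let := i.toAlgebra
  obtain ⟨s, hs⟩ := exists_isTranscendenceBasis K L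
  have := hs.isAlgebraic
  let g : MvPolynomial s K →+* L :=
    (MvPolynomial.aeval (R := K) ((↑) : s → L)).toRingHom.comp (MvPolynomial.map (τ : K →+* K))
  have hg : Function.Injective g :=
    Function.Injective.comp (g := MvPolynomial.aeval (R := K) ((↑) : s → L)) hs.1
      (MvPolynomial.map_injective _ τ.injective)
  let e := hs.1.aevalEquiv.symm
  obtain ⟨σ, hσ⟩ := _root_.exists_ringHom_extending (L := L)
    (g.comp (e : Algebra.adjoin K (Set.range ((↑) : s → L)) →+* MvPolynomial s K))
    (hg.comp e.injective)
  refine ⟨σ, fun x => (hσ (algebraMap K _ x)).trans ?_⟩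
  have he : e (algebraMap K _ x) = MvPolynomial.C x := e.commutes x
  simp only [RingHom.comp_apply, RingHom.coe_coe, he]
  simp [g]
  rfl

theorem zpow_eq_pow_of_pow_eq_one {G₀ : Type*} [GroupWithZero G₀] {w : G₀} {N : ℕ}
    (hN : N ≠ 0) (hw : w ^ N = 1) {a : ℕ} {m : ℤ} (h : (a : ZMod N) = (m : ZMod N)) :
    w ^ m = w ^ a := by
  have h0 : w ≠ 0 := by
    rintro rfl
    simp [hN] at hw
  obtain ⟨t, ht⟩ := (ZMod.intCast_eq_intCast_iff_dvd_sub (a : ℤ) m N).1 (by simpa using h)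
  obtain rfl : m = a + N * t := by linarith
  rw [zpow_add₀ h0, _root_.zpow_mul, zpow_natCast, zpow_natCast, hw, _root_.one_zpow, mul_one]

theorem exists_ringHom_zpow_rootsOfUnity (L : Type*) [Field L] [IsAlgClosed L] [CharZero L]
    {N : ℕ} (hN : N ≠ 0) {m : ℤ} (hm : IsCoprime m (N : ℤ)) :
    ∃ σ : L →+* L, ∀ w : L, w ^ N = 1 → σ w = w ^ m := by
  have : NeZero N := ⟨hN⟩
  obtain ⟨K, _, _, _⟩ : ∃ (K : Type) (_ : Field K) (_ : Algebra ℚ K),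
      IsCyclotomicExtension {N} ℚ K :=
    ⟨CyclotomicField N ℚ, inferInstance, CyclotomicField.algebra N ℚ, inferInstance⟩
  have : FiniteDimensional ℚ K := IsCyclotomicExtension.finiteDimensional {N} ℚ K
  have hζ := IsCyclotomicExtension.zeta_spec N ℚ K
  let u : (ZMod N)ˣ := ZMod.unitOfIsCoprime m hm
  let τ := (IsCyclotomicExtension.autEquivPow K
    (Polynomial.cyclotomic.irreducible_rat (NeZero.pos N))).symm u
  have hτ : τ (IsCyclotomicExtension.zeta N ℚ K) =
      IsCyclotomicExtension.zeta N ℚ K ^ (u : ZMod N).val := by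
    rw [← hζ.autToPow_spec ℚ τ]
    congr 3
    exact (IsCyclotomicExtension.autEquivPow K
      (Polynomial.cyclotomic.irreducible_rat (NeZero.pos N))).apply_symm_apply u
  let i : K →+* L := (IsAlgClosed.lift : K →ₐ[ℚ] L).toRingHom
  obtain ⟨σ, hσ⟩ := RingEquiv.exists_ringHom_extending i τ.toRingEquiv
  refine ⟨σ, fun w hw => ?_⟩
  rw [zpow_eq_pow_of_pow_eq_one hN hw (a := (u : ZMod N).val) (by simp [u])]
  obtain ⟨j, -, rfl⟩ := (hζ.map_of_injective i.injective).eq_pow_of_pow_eq_one hw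
  have hτ' : τ.toRingEquiv (IsCyclotomicExtension.zeta N ℚ K) = _ := hτ
  rw [map_pow, hσ, hτ', map_pow]
  exact pow_right_comm _ _ _

theorem Matrix.diagonal_zpow {I F : Type*} [Fintype I] [DecidableEq I] [Field F]
    {d : I → F} (hd : ∀ i, d i ≠ 0) (m : ℤ) :
    (Matrix.diagonal d) ^ m = Matrix.diagonal fun i => d i ^ m := by
  cases m with
  | ofNat a => simp [Matrix.diagonal_pow]
  | negSucc a =>
    rw [zpow_negSucc, Matrix.diagonal_pow]
    apply Matrix.inv_eq_left_inv
    rw [Matrix.diagonal_mul_diagonal, ← Matrix.diagonal_one]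
    congr 1
    funext i
    simp [hd i]

theorem Matrix.IsDiag.map_eq_zpow {I F : Type*} [Fintype I] [DecidableEq I] [Field F]
    {A : Matrix I I F} (hA : A.IsDiag) {c : ℕ} (hc : c ≠ 0) (hpow : A ^ c = 1) {m : ℤ}
    {σ : F →+* F} (hσ : ∀ w : F, w ^ c = 1 → σ w = w ^ m) :
    A.map σ = A ^ m := by
  obtain ⟨d, rfl⟩ : ∃ d, A = Matrix.diagonal d := ⟨_, hA.diagonal_diag.symm⟩
  rw [Matrix.diagonal_pow, ← Matrix.diagonal_one, Matrix.diagonal_injective.eq_iff] at hpow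
  have hd : ∀ i, d i ^ c = 1 := fun i => congrFun hpow i
  rw [Matrix.diagonal_zpow (fun i h => by simpa [h, hc] using hd i),
    Matrix.diagonal_map (map_zero σ)]
  congr 1
  funext i
  exact hσ _ (hd i)

theorem Matrix.IsDiag.commute {I R : Type*} [Fintype I] [DecidableEq I] [CommRing R]
    {A B : Matrix I I R} (hA : A.IsDiag) (hB : B.IsDiag) : Commute A B := by
  rw [← hA.diagonal_diag, ← hB.diagonal_diag]
  exact Matrix.commute_diagonal _ _

theorem Int.exists_mul_modEq_one {k c : ℤ} (h : IsCoprime k c) :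
    ∃ x, k * x ≡ 1 [ZMOD c] := by
  obtain ⟨a, b, hab⟩ := h
  exact ⟨a, (Int.modEq_iff_dvd.2 ⟨b, by linarith⟩)⟩

theorem Int.isCoprime_of_mul_modEq_one {k x c : ℤ} (h : k * x ≡ 1 [ZMOD c]) :
    IsCoprime x c := by
  obtain ⟨b, hb⟩ := Int.modEq_iff_dvd.1 h
  exact ⟨k, b, by linarith⟩

theorem Matrix.map_ringHom_inv {I F : Type*} [Fintype I] [DecidableEq I] [CommRing F]
    {A : Matrix I I F} (hA : IsUnit A) {σ : F →+* F} (h : A.map σ = A) : A⁻¹.map σ = A⁻¹ := by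
  symm
  apply Matrix.inv_eq_left_inv
  conv_lhs => rw [← h]
  rw [← Matrix.map_mul, h, Matrix.nonsing_inv_mul _ ((Matrix.isUnit_iff_isUnit_det A).1 hA)]
  simp

theorem stmt8
    {I : Type} [Fintype I] [DecidableEq I] [Nonempty I] (i0 : I)
    (ρ : SL2Z →* (Matrix I I ℂ)ˣ)
    (S T : Matrix I I ℂ)
    (hSdef : S = (↑(ρ sM) : Matrix I I ℂ)) (hTdef : T = (↑(ρ tM) : Matrix I I ℂ))
    (n N : ℕ) (hn : 0 < n) (hNpos : 0 < N) (hNdvd : N ∣ n)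
    (hTdiag : T.IsDiag) (hTord : orderOf T = N)
    (hSsymm : S.IsSymm) (hSunit : Sᴴ * S = 1)
    (ζ : ℂ) (hζ : ζ = Complex.exp (2 * Real.pi * Complex.I / n))
    (hSfield : ∀ p q, S p q ∈ IntermediateField.adjoin ℚ {ζ})
    (perm : ℤ → Equiv.Perm I) (ε : ℤ → I → ℂ) (G : ℤ → Matrix I I ℂ)
    (hε : ∀ l : ℤ, IsCoprime l (n : ℤ) → ∀ p, ε l p = 1 ∨ ε l p = -1)
    (hG : ∀ (l : ℤ) (p q : I), G l p q = ε l q * (if p = perm l q then 1 else 0))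
    (hGal : ∀ l : ℤ, IsCoprime l (n : ℤ) → ∀ σ : ℂ →+* ℂ, σ ζ = ζ ^ l →
      S.map σ = S * G l ∧ G l * S.map σ = S)
    (c : ℕ) (hc : 0 < c)
    (X : Matrix I I ℂ) (hXdiag : X.IsDiag) (hXpow : X ^ (c : ℕ) = T)
    (hXroot : ∀ p, X p p ^ n = 1)
    (Λ : ℤ → Matrix I I ℂ)
    (hΛ : ∀ (k x y : ℤ) (h : k * x - y * (c : ℤ) = 1),
      Λ k = X ^ (-k) *
        (↑(ρ ⟨!![k, y; (c : ℤ), x], by rw [Matrix.det_fin_two_of]; linarith⟩) : Matrix I I ℂ) *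
        X ^ (-x))
    (Z : ℤ → ℤ → Matrix I I ℂ)
    (hZdiag : ∀ u k : ℤ, IsCoprime u ((n : ℤ) * c) → IsCoprime k (c : ℤ) →
      (Z u k).IsDiag ∧ Z u k ^ (c : ℕ) = 1)
    (hZmod : ∀ u k k' : ℤ, IsCoprime u ((n : ℤ) * c) → k ≡ k' [ZMOD (c : ℤ)] → Z u k = Z u k')
    (hZgal : ∀ u : ℤ, IsCoprime u ((n : ℤ) * c) → ∀ k x : ℤ, IsCoprime k (c : ℤ) →
      k * x ≡ 1 [ZMOD (c : ℤ)] → ∀ uhat : ℤ, u * uhat ≡ 1 [ZMOD (c : ℤ)] →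
      ∀ σ : ℂ →+* ℂ, σ ζ = ζ ^ u →
        (Λ k).map σ = Λ (u * k) * G u * Z u x ∧
        (Λ k).map σ = Z u k * (G u)⁻¹ * Λ (uhat * k))
    (hZpow : ∀ u : ℤ, IsCoprime u ((n : ℤ) * c) → ∀ k k' : ℤ, IsCoprime k (c : ℤ) →
      IsCoprime k' (c : ℤ) → Z u (k' * k) = (Z u k) ^ k') :
    ∀ l m : ℤ, IsCoprime l ((n : ℤ) * c) → IsCoprime m ((n : ℤ) * c) →
      ∀ k : ℤ, IsCoprime k (c : ℤ) → ∀ lhat : ℤ, l * lhat ≡ 1 [ZMOD (c : ℤ)] →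
        (G l)⁻¹ * Z m (lhat * k) * G l = Z (l * m) k * (Z l k) ^ (-m) := by
  intro l m hl hm k hk lhat hlhat
  have hc0 : c ≠ 0 := hc.ne'
  have hnc : n * c ≠ 0 := mul_ne_zero hn.ne' hc0
  have coprime_n : ∀ u : ℤ, IsCoprime u ((n : ℤ) * c) → IsCoprime u (n : ℤ) :=
    fun u hu => hu.of_isCoprime_of_dvd_right (dvd_mul_right _ _)
  have coprime_c : ∀ u : ℤ, IsCoprime u ((n : ℤ) * c) → IsCoprime u (c : ℤ) :=
    fun u hu => hu.of_isCoprime_of_dvd_right (dvd_mul_left _ _)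
  have hζn : ζ ^ n = 1 := by
    rw [hζ]
    exact (Complex.isPrimitiveRoot_exp n hn.ne').pow_eq_one
  have exists_hom : ∀ u : ℤ, IsCoprime u ((n : ℤ) * c) →
      ∃ σ : ℂ →+* ℂ, σ ζ = ζ ^ u ∧ ∀ w : ℂ, w ^ c = 1 → σ w = w ^ u := by
    intro u hu
    obtain ⟨σ, hσ⟩ := exists_ringHom_zpow_rootsOfUnity ℂ hnc (m := u) (by simpa using hu)
    exact ⟨σ, hσ ζ (by rw [pow_mul, hζn, one_pow]),
      fun w hw => hσ w (by rw [mul_comm, pow_mul, hw, one_pow])⟩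
  have hS : IsUnit S := by rw [hSdef]; exact (ρ sM).isUnit
  have hX : IsUnit X := by
    have hT : IsUnit T := by rw [hTdef]; exact (ρ tM).isUnit
    rw [← hXpow] at hT
    exact (isUnit_pow_iff hc0).1 hT
  have isUnit_X_zpow : ∀ a : ℤ, IsUnit (X ^ a) := fun a =>
    (Matrix.isUnit_iff_isUnit_det _).2 (((Matrix.isUnit_iff_isUnit_det X).1 hX).det_zpow a)
  have isUnit_Λ : ∀ a : ℤ, IsCoprime a (c : ℤ) → IsUnit (Λ a) := by
    rintro a ⟨x, y, hxy⟩
    rw [hΛ a x (-y) (by linarith)]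
    exact ((isUnit_X_zpow _).mul (Units.isUnit _)).mul (isUnit_X_zpow _)
  have isUnit_G : ∀ u : ℤ, IsCoprime u ((n : ℤ) * c) → IsUnit (G u) := by
    intro u hu
    obtain ⟨σ, hσ, -⟩ := exists_hom u hu
    have h := hS
    rw [← (hGal u (coprime_n u hu) σ hσ).2] at h
    exact isUnit_of_mul_isUnit_left h
  have map_G : ∀ u : ℤ, IsCoprime u ((n : ℤ) * c) → ∀ σ : ℂ →+* ℂ, (G u).map σ = G u := by
    intro u hu σ
    ext p q
    rw [Matrix.map_apply, hG]
    rcases hε u (coprime_n u hu) q with h | h <;> simp [h, apply_ite σ]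
  have hlm : IsCoprime (l * m) ((n : ℤ) * c) := hl.mul_left hm
  obtain ⟨σ, hσζ, -⟩ := exists_hom l hl
  obtain ⟨τ, hτζ, hτ⟩ := exists_hom m hm
  have hτσ : (τ.comp σ) ζ = ζ ^ (l * m) := by
    rw [RingHom.comp_apply, hσζ, map_zpow₀, hτζ, ← _root_.zpow_mul, mul_comm]
  have map_comp : ∀ A : Matrix I I ℂ, A.map (τ.comp σ) = (A.map σ).map τ := fun A => by
    rw [Matrix.map_map]; rfl
  have hGlm : G (l * m) = G m * G l := by
    apply hS.mul_left_cancel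
    rw [← (hGal _ (coprime_n _ hlm) _ hτσ).1, map_comp, (hGal l (coprime_n l hl) σ hσζ).1,
      Matrix.map_mul, map_G l hl, (hGal m (coprime_n m hm) τ hτζ).1, mul_assoc]
  obtain ⟨mhat, hmhat⟩ := Int.exists_mul_modEq_one (coprime_c m hm)
  obtain ⟨x, hx⟩ := Int.exists_mul_modEq_one hk
  have hlk : IsCoprime (lhat * k) (c : ℤ) := (Int.isCoprime_of_mul_modEq_one hlhat).mul_left hk
  obtain ⟨x', hx'⟩ := Int.exists_mul_modEq_one hlk
  have hlmhat : (l * m) * (mhat * lhat) ≡ 1 [ZMOD (c : ℤ)] := by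
    have h := hlhat.mul hmhat
    rwa [one_mul, show l * lhat * (m * mhat) = l * m * (mhat * lhat) by ring] at h
  have h₁ := (hZgal l hl k x hk hx lhat hlhat σ hσζ).2
  have h₂ := (hZgal m hm (lhat * k) x' hlk hx' mhat hmhat τ hτζ).2
  have h₃ := (hZgal (l * m) hlm k x hk hx (mhat * lhat) hlmhat _ hτσ).2
  obtain ⟨hZl, hZlc⟩ := hZdiag l k hl hk
  rw [map_comp, h₁, Matrix.map_mul, Matrix.map_mul, h₂, Matrix.map_ringHom_inv (isUnit_G l hl)
    (map_G l hl τ), hZl.map_eq_zpow hc0 hZlc hτ, hGlm, Matrix.mul_inv_rev, mul_assoc mhat] at h₃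
  have hΛ' := isUnit_Λ (mhat * (lhat * k)) ((Int.isCoprime_of_mul_modEq_one hmhat).mul_left hlk)
  have hGm : IsUnit (G m)⁻¹ := Matrix.isUnit_nonsing_inv_iff.2 (isUnit_G m hm)
  have key : Z l k ^ m * ((G l)⁻¹ * Z m (lhat * k)) = Z (l * m) k * (G l)⁻¹ := by
    apply hGm.mul_right_cancel
    apply hΛ'.mul_right_cancel
    simpa only [mul_assoc] using h₃
  have hZu : IsUnit (Z l k).det :=
    (Matrix.isUnit_iff_isUnit_det _).1 (IsUnit.of_pow_eq_one hZlc hc0)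
  calc (G l)⁻¹ * Z m (lhat * k) * G l
      = Z l k ^ (-m) * (Z l k ^ m * ((G l)⁻¹ * Z m (lhat * k))) * G l := by
        rw [← mul_assoc (Z l k ^ (-m)), Matrix.zpow_neg_mul_zpow_self m hZu, one_mul]
    _ = Z l k ^ (-m) * Z (l * m) k := by
        rw [key, mul_assoc, mul_assoc, Matrix.nonsing_inv_mul _
          ((Matrix.isUnit_iff_isUnit_det _).1 (isUnit_G l hl)), mul_one]
    _ = Z (l * m) k * Z l k ^ (-m) :=
        (Matrix.Commute.zpow_right ((hZdiag _ k hlm hk).1.commute hZl) (-m)).symm.eq
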